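/- arXiv:1903.00311 — 2 statements merged into one kernel-verified Lean document; each statement's English description precedes it below -/
import Mathlib

section
/- Let ρ > 0 and δ ∈ (0, ρ), let ω ∈ (0,1) be irrational, and let a ∈ 𝒫₀(ρ) with Fourier coefficients a_{p,q}. If ser(δ) = Σ_{(p,q)∈ℤ²∖{(0,0)}} e^{−(|p|+|q|)δ}/|qω − p| < ∞, then the series g(x,y) = Σ_{(p,q)∈ℤ²∖{(0,0)}} (a_{p,q}/(i(p − qω))) e_{p,q}(x,y) converges uniformly on cl(Π(ρ−δ))² to a function g ∈ 𝒫₀(ρ−δ) which satisfies (∂_x + ω∂_y) g = a on Π(ρ−δ)² and ‖g‖_{ρ−δ} ≤ ser(δ) · ‖a‖_ρ. -/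
open Real Complex
open scoped ENNReal

noncomputable section

/-- The open horizontal strip `Π(ρ) = {z ∈ ℂ : |Im z| < ρ}`. -/
def openStrip (ρ : ℝ) : Set ℂ := {z : ℂ | |z.im| < ρ}

/-- The closed horizontal strip `cl(Π(ρ)) = {z ∈ ℂ : |Im z| ≤ ρ}`. -/
def closedStrip (ρ : ℝ) : Set ℂ := {z : ℂ | |z.im| ≤ ρ}

/-- The Fourier basis function `e_{p,q}(x,y) = exp(i(px - qy))`. -/
def efun (p q : ℤ) (z : ℂ × ℂ) : ℂ :=
  Complex.exp (Complex.I * ((p : ℂ) * z.1 - (q : ℂ) * z.2))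

/-- Membership in the class `𝒫₀(ρ)`: continuous on the closed bi-strip, holomorphic on the
open bi-strip, `2π`-periodic in each variable, real-valued on `ℝ²`, with zero average. -/
structure MemP0 (ρ : ℝ) (b : ℂ × ℂ → ℂ) : Prop where
  contOn : ContinuousOn b (closedStrip ρ ×ˢ closedStrip ρ)
  diffOn : DifferentiableOn ℂ b (openStrip ρ ×ˢ openStrip ρ)
  periodic_fst : ∀ z : ℂ × ℂ, b (z.1 + 2 * Real.pi, z.2) = b z
  periodic_snd : ∀ z : ℂ × ℂ, b (z.1, z.2 + 2 * Real.pi) = b z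
  real_on_real : ∀ x y : ℝ, (b ((x : ℂ), (y : ℂ))).im = 0
  zero_avg : (∫ x in (0 : ℝ)..(2 * Real.pi), ∫ y in (0 : ℝ)..(2 * Real.pi),
    b ((x : ℂ), (y : ℂ))) = 0

/-- The sup norm `‖b‖_ρ` over the closed bi-strip. -/
def supNorm (ρ : ℝ) (b : ℂ × ℂ → ℂ) : ℝ :=
  ⨆ z : (closedStrip ρ ×ˢ closedStrip ρ : Set (ℂ × ℂ)), ‖b z‖

/-- The `(p,q)`-th Fourier coefficient
`b_{p,q} = (2π)⁻² ∫∫ b(x,y) e^{-i(px-qy)} dx dy`. -/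
def fcoeff (b : ℂ × ℂ → ℂ) (p q : ℤ) : ℂ :=
  (1 / (2 * Real.pi) ^ 2 : ℝ) *
    ∫ x in (0 : ℝ)..(2 * Real.pi), ∫ y in (0 : ℝ)..(2 * Real.pi),
      b ((x : ℂ), (y : ℂ)) * Complex.exp (-Complex.I * ((p : ℂ) * x - (q : ℂ) * y))

/-- The cohomological operator `(∂_x + ω ∂_y) g` at `z`. -/
def cohomOp (ω : ℝ) (g : ℂ × ℂ → ℂ) (z : ℂ × ℂ) : ℂ :=
  fderiv ℂ g z (1, 0) + (ω : ℂ) * fderiv ℂ g z (0, 1)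

end

open MeasureTheory in
theorem mFourierCoeff_fin_two_eq_intervalIntegral (G : C(UnitAddTorus (Fin 2), ℂ))
    (n : Fin 2 → ℤ) :
    UnitAddTorus.mFourierCoeff G n = ∫ x in (0 : ℝ)..1, ∫ y in (0 : ℝ)..1,
      UnitAddTorus.mFourier (-n) ![(x : UnitAddCircle), (y : UnitAddCircle)] *
        G ![(x : UnitAddCircle), (y : UnitAddCircle)] := by
  unfold UnitAddTorus.mFourierCoeff
  have hv : (AddCircle.haarAddCircle : Measure UnitAddCircle) = volume := by
    rw [AddCircle.volume_eq_smul_haarAddCircle, ENNReal.ofReal_one, one_smul]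
  refine ((measurePreserving_finTwoArrow
    (AddCircle.haarAddCircle : Measure UnitAddCircle)).symm.integral_comp'
    (fun t : UnitAddTorus (Fin 2) => UnitAddTorus.mFourier (-n) t • G t)).symm.trans ?_
  rw [hv, integral_prod]
  · rw [← UnitAddCircle.intervalIntegral_preimage 0]
    simp_rw [← UnitAddCircle.intervalIntegral_preimage 0]
    simp only [zero_add]
    rfl
  · have hc : Continuous fun x : UnitAddCircle × UnitAddCircle =>
        UnitAddTorus.mFourier (-n) ![x.1, x.2] • G ![x.1, x.2] := by
      have : Continuous fun x : UnitAddCircle × UnitAddCircle => ![x.1, x.2] := by fun_prop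
      exact ((UnitAddTorus.mFourier (-n)).continuous.comp this).smul (G.continuous.comp this)
    exact hc.integrable_of_hasCompactSupport (HasCompactSupport.of_compactSpace _)

theorem exists_continuousMap_unitAddTorus (F : (Fin 2 → ℝ) → ℂ) (hF : Continuous F)
    (hper : ∀ v w : Fin 2 → ℝ, (∀ i, ∃ k : ℤ, v i = w i + k) → F v = F w) :
    ∃ G : C(UnitAddTorus (Fin 2), ℂ), ∀ v : Fin 2 → ℝ, G (fun i => (v i : UnitAddCircle)) = F v := by
  have hq : IsOpenQuotientMap
      (Pi.map (fun (_ : Fin 2) (x : ℝ) => (x : UnitAddCircle))) :=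
    .piMap fun _ => QuotientAddGroup.isOpenQuotientMap_mk
  have hcomp : ∀ v : Fin 2 → ℝ,
      F (Function.surjInv hq.surjective (fun i => (v i : UnitAddCircle))) = F v := by
    intro v
    apply hper
    intro i
    have h := congrFun (Function.surjInv_eq hq.surjective (fun i => (v i : UnitAddCircle))) i
    simp only [Pi.map_apply] at h
    rw [← sub_eq_zero, ← AddCircle.coe_sub, AddCircle.coe_eq_zero_iff] at h
    obtain ⟨k, hk⟩ := h
    exact ⟨k, by simp only [zsmul_eq_mul, mul_one] at hk; linarith⟩
  refine ⟨⟨fun t => F (Function.surjInv hq.surjective t), ?_⟩, hcomp⟩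
  rw [hq.isQuotientMap.continuous_iff]
  exact hF.congr fun v => (hcomp v).symm

theorem eq_of_periodic_of_eq_add_int_mul {f : ℝ → ℂ} {T : ℝ} (hf : Function.Periodic f T) {x y : ℝ}
    {k : ℤ} (h : x = y + k * T) : f x = f y := by
  rw [h]
  exact hf.int_mul k y

/-- A continuous doubly `2π`-periodic function with summable Fourier coefficients is the sum of
its Fourier series. -/
theorem hasSum_fourier_series_of_doubly_periodic (f : ℝ → ℝ → ℂ)
    (hf : Continuous (Function.uncurry f))
    (h1 : ∀ x y, f (x + 2 * Real.pi) y = f x y) (h2 : ∀ x y, f x (y + 2 * Real.pi) = f x y)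
    (c : ℤ → ℤ → ℂ)
    (hc : ∀ p q, c p q = (1 / (2 * Real.pi) ^ 2 : ℝ) *
      ∫ x in (0 : ℝ)..(2 * Real.pi), ∫ y in (0 : ℝ)..(2 * Real.pi),
        f x y * Complex.exp (-Complex.I * ((p : ℂ) * x - (q : ℂ) * y)))
    (hs : Summable fun pq : ℤ × ℤ => c pq.1 pq.2) (x y : ℝ) :
    HasSum (fun pq : ℤ × ℤ => c pq.1 pq.2 *
      Complex.exp (Complex.I * ((pq.1 : ℂ) * x - (pq.2 : ℂ) * y))) (f x y) := by
  have hpi : (2 * Real.pi) ≠ 0 := by positivity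
  obtain ⟨G, hG⟩ := exists_continuousMap_unitAddTorus
    (fun v => f (2 * Real.pi * v 0) (2 * Real.pi * v 1))
    (by
      have : Continuous fun v : Fin 2 → ℝ => (2 * Real.pi * v 0, 2 * Real.pi * v 1) := by fun_prop
      exact hf.comp this)
    (by
      intro v w h
      obtain ⟨k, hk⟩ := h 0
      obtain ⟨l, hl⟩ := h 1
      have e1 : f (2 * Real.pi * v 0) (2 * Real.pi * v 1)
          = f (2 * Real.pi * w 0) (2 * Real.pi * v 1) :=
        eq_of_periodic_of_eq_add_int_mul (f := fun x => f x (2 * Real.pi * v 1)) (fun x => h1 x _)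
          (k := k) (by rw [hk]; ring)
      have e2 : f (2 * Real.pi * w 0) (2 * Real.pi * v 1)
          = f (2 * Real.pi * w 0) (2 * Real.pi * w 1) :=
        eq_of_periodic_of_eq_add_int_mul (f := fun y => f (2 * Real.pi * w 0) y) (fun x => h2 _ x)
          (k := l) (by rw [hl]; ring)
      exact e1.trans e2)
  have hG2 : ∀ s t : ℝ, G ![(s : UnitAddCircle), (t : UnitAddCircle)]
      = f (2 * Real.pi * s) (2 * Real.pi * t) := by
    intro s t
    have := hG ![s, t]
    simp only [Matrix.cons_val_zero, Matrix.cons_val_one] at this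
    rw [← this]
    congr 1
    ext i
    fin_cases i <;> rfl
  have hm : ∀ (n : Fin 2 → ℤ) (s t : ℝ),
      UnitAddTorus.mFourier n ![(s : UnitAddCircle), (t : UnitAddCircle)]
      = Complex.exp (Complex.I * ((n 0 : ℂ) * (2 * Real.pi * s : ℝ)
          - ((-n 1 : ℤ) : ℂ) * (2 * Real.pi * t : ℝ))) := by
    intro n s t
    simp only [UnitAddTorus.mFourier, ContinuousMap.coe_mk, Fin.prod_univ_two,
      Matrix.cons_val_zero, Matrix.cons_val_one]
    rw [fourier_coe_apply, fourier_coe_apply, ← Complex.exp_add]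
    congr 1
    push_cast
    ring
  have hcoef : ∀ n : Fin 2 → ℤ, UnitAddTorus.mFourierCoeff G n = c (n 0) (-n 1) := by
    intro n
    rw [mFourierCoeff_fin_two_eq_intervalIntegral, hc]
    simp_rw [hm, hG2]
    have inner : ∀ s : ℝ, (∫ t in (0 : ℝ)..1,
        Complex.exp (Complex.I * (((-n) 0 : ℂ) * (2 * Real.pi * s : ℝ)
          - ((-(-n) 1 : ℤ) : ℂ) * (2 * Real.pi * t : ℝ))) * f (2 * Real.pi * s) (2 * Real.pi * t))
        = (2 * Real.pi)⁻¹ • ∫ t in (0 : ℝ)..(2 * Real.pi),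
        Complex.exp (Complex.I * (((-n) 0 : ℂ) * (2 * Real.pi * s : ℝ)
          - ((-(-n) 1 : ℤ) : ℂ) * (t : ℝ))) * f (2 * Real.pi * s) t := by
      intro s
      have := intervalIntegral.integral_comp_mul_left (a := 0) (b := 1) (c := 2 * Real.pi)
        (fun t : ℝ => Complex.exp (Complex.I * (((-n) 0 : ℂ) * (2 * Real.pi * s : ℝ)
          - ((-(-n) 1 : ℤ) : ℂ) * (t : ℝ))) * f (2 * Real.pi * s) t) hpi
      rwa [mul_zero, mul_one] at this
    simp_rw [inner]
    have outer := intervalIntegral.integral_comp_mul_left (a := 0) (b := 1) (c := 2 * Real.pi)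
        (fun s : ℝ => (2 * Real.pi)⁻¹ • ∫ t in (0 : ℝ)..(2 * Real.pi),
          Complex.exp (Complex.I * (((-n) 0 : ℂ) * (s : ℝ)
          - ((-(-n) 1 : ℤ) : ℂ) * (t : ℝ))) * f s t) hpi
    rw [mul_zero, mul_one] at outer
    rw [outer, intervalIntegral.integral_smul, smul_smul, Complex.real_smul]
    congr 1
    · congr 1; field_simp
    · refine intervalIntegral.integral_congr fun x _ => intervalIntegral.integral_congr fun y _ => ?_
      simp only [Pi.neg_apply]
      rw [mul_comm]
      congr 2
      push_cast
      ring
  let e : (Fin 2 → ℤ) ≃ ℤ × ℤ := (finTwoArrowEquiv ℤ).trans ((Equiv.refl ℤ).prodCongr (Equiv.neg ℤ))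
  have he : ∀ n, e n = (n 0, -n 1) := fun n => rfl
  have hsum : Summable (UnitAddTorus.mFourierCoeff G) := by
    have := e.summable_iff.2 hs
    refine this.congr fun n => ?_
    rw [hcoef, Function.comp_apply, he]
  have key := UnitAddTorus.hasSum_mFourier_series_apply_of_summable hsum
    ![((x / (2 * Real.pi) : ℝ) : UnitAddCircle), ((y / (2 * Real.pi) : ℝ) : UnitAddCircle)]
  rw [hG2, mul_div_cancel₀ _ hpi, mul_div_cancel₀ _ hpi] at key
  rw [← e.hasSum_iff]
  refine key.congr_fun fun n => ?_
  rw [hm, hcoef, Function.comp_apply, he, smul_eq_mul, mul_div_cancel₀ _ hpi,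
    mul_div_cancel₀ _ hpi]

theorem isOpen_openStrip (ρ : ℝ) : IsOpen (openStrip ρ) :=
  isOpen_lt (by fun_prop) continuous_const

theorem openStrip_subset_closedStrip (ρ : ℝ) : openStrip ρ ⊆ closedStrip ρ :=
  fun z hz => show |z.im| ≤ ρ from le_of_lt hz

theorem convex_openStrip (ρ : ℝ) : Convex ℝ (openStrip ρ) := by
  have : openStrip ρ = Complex.imLm ⁻¹' (Set.Ioo (-ρ) ρ) := by
    ext z
    simp [openStrip, abs_lt]
  rw [this]
  exact (convex_Ioo _ _).linear_preimage _

/-- The integral over a period of a periodic holomorphic function does not change when the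
horizontal contour is moved inside the strip. -/
theorem intervalIntegral_add_mul_I_eq {ρ σ : ℝ} {f : ℂ → ℂ}
    (hf : DifferentiableOn ℂ f (openStrip ρ))
    (hper : ∀ z, f (z + 2 * Real.pi) = f z) (hσ : |σ| < ρ) :
    ∫ x in (0 : ℝ)..(2 * Real.pi), f (x + σ * Complex.I)
      = ∫ x in (0 : ℝ)..(2 * Real.pi), f x := by
  have hsub : (Set.uIcc (0 : ℂ).re (2 * Real.pi + σ * Complex.I : ℂ).re ×ℂ
      Set.uIcc (0 : ℂ).im (2 * Real.pi + σ * Complex.I : ℂ).im) ⊆ openStrip ρ := by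
    intro z hz
    have h2 := hz.2
    simp only [Set.mem_preimage, Complex.zero_im, Complex.add_im, Complex.mul_im, Complex.re_ofNat,
      Complex.ofReal_im, Complex.im_ofNat, Complex.ofReal_re, Complex.I_re, Complex.I_im, mul_zero,
      zero_mul, add_zero, mul_one, zero_add] at h2
    have := Set.abs_sub_left_of_mem_uIcc h2
    simp only [sub_zero] at this
    exact this.trans_lt hσ
  have h := Complex.integral_boundary_rect_eq_zero_of_differentiableOn f 0
    (2 * Real.pi + σ * Complex.I) (hf.mono hsub)
  simp only [Complex.zero_im, Complex.add_im, Complex.mul_im, Complex.re_ofNat, Complex.zero_re,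
    Complex.add_re, Complex.mul_re,
    Complex.ofReal_im, Complex.im_ofNat, Complex.ofReal_re, Complex.I_re, Complex.I_im, mul_zero,
    zero_mul, add_zero, mul_one, zero_add, sub_zero, Complex.ofReal_zero, sub_self] at h
  have hv : ∀ y : ℝ, f (((2 * Real.pi : ℝ) : ℂ) + y * Complex.I) = f (y * Complex.I) := by
    intro y
    rw [← hper (y * Complex.I)]
    congr 1
    push_cast
    ring
  simp_rw [hv] at h
  rw [add_sub_cancel_right, sub_eq_zero] at h
  exact h.symm

/-- The two-variable version of the contour shift. -/
theorem intervalIntegral_intervalIntegral_add_mul_I_eq {ρ σ τ : ℝ} {h : ℂ × ℂ → ℂ}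
    (hd : DifferentiableOn ℂ h (openStrip ρ ×ˢ openStrip ρ))
    (h1 : ∀ z : ℂ × ℂ, h (z.1 + 2 * Real.pi, z.2) = h z)
    (h2 : ∀ z : ℂ × ℂ, h (z.1, z.2 + 2 * Real.pi) = h z)
    (hσ : |σ| < ρ) (hτ : |τ| < ρ) :
    ∫ x in (0 : ℝ)..(2 * Real.pi), ∫ y in (0 : ℝ)..(2 * Real.pi),
        h ((x : ℂ) + σ * Complex.I, (y : ℂ) + τ * Complex.I)
      = ∫ x in (0 : ℝ)..(2 * Real.pi), ∫ y in (0 : ℝ)..(2 * Real.pi), h ((x : ℂ), (y : ℂ)) := by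
  have hρ : 0 < ρ := (abs_nonneg σ).trans_lt hσ
  have hreal : ∀ x : ℝ, (x : ℂ) ∈ openStrip ρ := fun x => by simpa [openStrip] using hρ
  have hshift : ∀ x : ℝ, (x : ℂ) + σ * Complex.I ∈ openStrip ρ := fun x => by
    simpa [openStrip] using hσ
  have hy : ∀ x : ℝ, ∫ y in (0 : ℝ)..(2 * Real.pi),
      h ((x : ℂ) + σ * Complex.I, (y : ℂ) + τ * Complex.I)
      = ∫ y in (0 : ℝ)..(2 * Real.pi), h ((x : ℂ) + σ * Complex.I, (y : ℂ)) := fun x =>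
    intervalIntegral_add_mul_I_eq (f := fun w => h ((x : ℂ) + σ * Complex.I, w))
      (hd.comp (by fun_prop) fun w hw => ⟨hshift x, hw⟩) (fun w => h2 (_, w)) hτ
  have hx : ∀ y : ℝ, ∫ x in (0 : ℝ)..(2 * Real.pi), h ((x : ℂ) + σ * Complex.I, (y : ℂ))
      = ∫ x in (0 : ℝ)..(2 * Real.pi), h ((x : ℂ), (y : ℂ)) := fun y =>
    intervalIntegral_add_mul_I_eq (f := fun w => h (w, (y : ℂ)))
      (hd.comp (by fun_prop) fun w hw => ⟨hw, hreal y⟩) (fun w => h1 (w, _)) hσ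
  have swap : ∀ F : ℝ → ℝ → ℂ, Continuous (Function.uncurry F) →
      ∫ x in (0 : ℝ)..(2 * Real.pi), ∫ y in (0 : ℝ)..(2 * Real.pi), F x y
      = ∫ y in (0 : ℝ)..(2 * Real.pi), ∫ x in (0 : ℝ)..(2 * Real.pi), F x y := by
    intro F hF
    apply MeasureTheory.intervalIntegral_intervalIntegral_swap
    exact (hF.continuousOn.integrableOn_compact
      (isCompact_uIcc.prod isCompact_uIcc)).mono_set
      (Set.prod_mono Set.uIoc_subset_uIcc Set.uIoc_subset_uIcc)
  simp_rw [hy]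
  refine (swap (fun x y => h ((x : ℂ) + σ * Complex.I, (y : ℂ))) ?_).trans ?_
  · exact hd.continuousOn.comp_continuous
      (f := fun p : ℝ × ℝ => ((p.1 : ℂ) + σ * Complex.I, (p.2 : ℂ)))
      (by fun_prop) fun p => ⟨hshift _, hreal _⟩
  · simp_rw [hx]
    refine (swap (fun x y => h ((x : ℂ), (y : ℂ))) ?_).symm
    exact hd.continuousOn.comp_continuous (f := fun p : ℝ × ℝ => ((p.1 : ℂ), (p.2 : ℂ)))
      (by fun_prop) fun p => ⟨hreal _, hreal _⟩

theorem exp_I_mul_int_mul_add_two_pi (n : ℤ) (u v : ℂ) :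
    Complex.exp (Complex.I * (n * (u + 2 * Real.pi) + v)) = Complex.exp (Complex.I * (n * u + v)) := by
  have : Complex.I * (n * (u + 2 * Real.pi) + v)
      = Complex.I * (n * u + v) + n * (2 * Real.pi * Complex.I) := by ring
  rw [this]
  exact Complex.exp_periodic.int_mul n _

theorem efun_add_two_pi_fst (p q : ℤ) (z : ℂ × ℂ) :
    efun p q (z.1 + 2 * Real.pi, z.2) = efun p q z := by
  simp only [efun, sub_eq_add_neg]
  exact exp_I_mul_int_mul_add_two_pi p _ _

theorem efun_add_two_pi_snd (p q : ℤ) (z : ℂ × ℂ) :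
    efun p q (z.1, z.2 + 2 * Real.pi) = efun p q z := by
  have h := exp_I_mul_int_mul_add_two_pi (-q) z.2 (p * z.1)
  simp only [efun]
  convert h using 3 <;> push_cast <;> ring

theorem norm_efun (p q : ℤ) (z : ℂ × ℂ) :
    ‖efun p q z‖ = Real.exp (q * z.2.im - p * z.1.im) := by
  simp [efun, Complex.norm_exp]

theorem efun_neg (p q : ℤ) (z : ℂ × ℂ) :
    efun (-p) (-q) z = Complex.exp (-Complex.I * ((p : ℂ) * z.1 - (q : ℂ) * z.2)) := by
  simp only [efun]
  congr 1
  push_cast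
  ring

theorem efun_mul_efun_neg (p q : ℤ) (z : ℂ × ℂ) : efun p q z * efun (-p) (-q) z = 1 := by
  rw [efun, efun, ← Complex.exp_add, Complex.exp_eq_one_iff]
  exact ⟨0, by push_cast; ring⟩

theorem efun_add (p q : ℤ) (z w : ℂ × ℂ) : efun p q (z + w) = efun p q z * efun p q w := by
  rw [efun, efun, efun, ← Complex.exp_add]
  congr 1
  simp only [Prod.fst_add, Prod.snd_add]
  ring

theorem hasFDerivAt_efun (p q : ℤ) (z : ℂ × ℂ) :
    HasFDerivAt (efun p q) (efun p q z • (Complex.I •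
      ((p : ℂ) • ContinuousLinearMap.fst ℂ ℂ ℂ - (q : ℂ) • ContinuousLinearMap.snd ℂ ℂ ℂ))) z := by
  have h : HasFDerivAt (fun z : ℂ × ℂ => Complex.I * ((p : ℂ) * z.1 - (q : ℂ) * z.2))
      (Complex.I • ((p : ℂ) • ContinuousLinearMap.fst ℂ ℂ ℂ
        - (q : ℂ) • ContinuousLinearMap.snd ℂ ℂ ℂ)) z :=
    ((hasFDerivAt_fst.const_mul _).sub (hasFDerivAt_snd.const_mul _)).const_mul _
  exact h.cexp

theorem continuous_efun (p q : ℤ) : Continuous (efun p q) := by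
  unfold efun
  fun_prop

/-- The Fourier coefficients can be computed on any real torus `(ℝ + iσ) × (ℝ + iτ)`. -/
theorem MemP0.fcoeff_eq_shift {ρ σ τ : ℝ} {b : ℂ × ℂ → ℂ} (hb : MemP0 ρ b)
    (hσ : |σ| < ρ) (hτ : |τ| < ρ) (p q : ℤ) :
    fcoeff b p q = (1 / (2 * Real.pi) ^ 2 : ℝ) *
      ∫ x in (0 : ℝ)..(2 * Real.pi), ∫ y in (0 : ℝ)..(2 * Real.pi),
        b ((x : ℂ) + σ * Complex.I, (y : ℂ) + τ * Complex.I) *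
          efun (-p) (-q) ((x : ℂ) + σ * Complex.I, (y : ℂ) + τ * Complex.I) := by
  rw [intervalIntegral_intervalIntegral_add_mul_I_eq (h := fun z => b z * efun (-p) (-q) z)
    (hb.diffOn.mul fun z _ => (hasFDerivAt_efun _ _ z).differentiableAt.differentiableWithinAt)
    (fun z => by rw [hb.periodic_fst, efun_add_two_pi_fst])
    (fun z => by rw [hb.periodic_snd, efun_add_two_pi_snd]) hσ hτ]
  simp only [efun_neg]
  rfl

theorem exists_add_int_mul_two_pi_mem_Icc (z : ℂ) :
    ∃ k : ℤ, (z + k * (2 * Real.pi)).re ∈ Set.Icc 0 (2 * Real.pi) := by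
  obtain ⟨k, hk, -⟩ := existsUnique_add_zsmul_mem_Ico (show 0 < 2 * Real.pi by positivity) z.re 0
  refine ⟨k, ?_⟩
  simp only [zsmul_eq_mul, zero_add] at hk
  have : (z + k * (2 * Real.pi)).re = z.re + k * (2 * Real.pi) := by simp
  rw [this]
  exact ⟨hk.1, hk.2.le⟩

theorem MemP0.bddAbove_norm {ρ : ℝ} {b : ℂ × ℂ → ℂ} (hb : MemP0 ρ b) :
    BddAbove (Set.range fun z : (closedStrip ρ ×ˢ closedStrip ρ : Set (ℂ × ℂ)) => ‖b z‖) := by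
  have hK : IsCompact (Set.Icc 0 (2 * Real.pi) ×ℂ Set.Icc (-ρ) ρ) :=
    isCompact_Icc.reProdIm isCompact_Icc
  have hsub : (Set.Icc 0 (2 * Real.pi) ×ℂ Set.Icc (-ρ) ρ) ⊆ closedStrip ρ :=
    fun z hz => abs_le.2 hz.2
  obtain ⟨C, hC⟩ := (hK.prod hK).exists_bound_of_continuousOn
    (hb.contOn.mono (Set.prod_mono hsub hsub))
  refine ⟨C, ?_⟩
  rintro _ ⟨⟨⟨z, w⟩, hz, hw⟩, rfl⟩
  obtain ⟨k, hk⟩ := exists_add_int_mul_two_pi_mem_Icc z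
  obtain ⟨l, hl⟩ := exists_add_int_mul_two_pi_mem_Icc w
  have e1 : b (z + k * (2 * Real.pi), w) = b (z, w) :=
    Function.Periodic.int_mul (f := fun z => b (z, w)) (fun z => hb.periodic_fst (z, w)) k z
  have e2 : b (z + k * (2 * Real.pi), w + l * (2 * Real.pi)) = b (z + k * (2 * Real.pi), w) :=
    Function.Periodic.int_mul (f := fun w => b (z + k * (2 * Real.pi), w))
      (fun w => hb.periodic_snd (_, w)) l w
  show ‖b (z, w)‖ ≤ C
  rw [← e1, ← e2]
  refine hC _ ⟨⟨hk, ?_⟩, ⟨hl, ?_⟩⟩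
  · exact abs_le.1 (by simpa [closedStrip] using hz)
  · exact abs_le.1 (by simpa [closedStrip] using hw)

theorem MemP0.norm_le_supNorm {ρ : ℝ} {b : ℂ × ℂ → ℂ} (hb : MemP0 ρ b) {z : ℂ × ℂ}
    (hz : z ∈ closedStrip ρ ×ˢ closedStrip ρ) : ‖b z‖ ≤ supNorm ρ b :=
  le_ciSup hb.bddAbove_norm ⟨z, hz⟩

theorem supNorm_nonneg (ρ : ℝ) (b : ℂ × ℂ → ℂ) : 0 ≤ supNorm ρ b :=
  Real.iSup_nonneg fun _ => norm_nonneg _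

theorem exists_abs_eq_and_mul_eq_neg {r : ℝ} (hr : 0 ≤ r) (p : ℝ) :
    ∃ σ : ℝ, |σ| ≤ r ∧ p * σ = -(|p| * r) := by
  rcases le_total 0 p with hp | hp
  · exact ⟨-r, by rw [abs_neg, abs_of_nonneg hr], by rw [abs_of_nonneg hp]; ring⟩
  · exact ⟨r, (abs_of_nonneg hr).le, by rw [abs_of_nonpos hp]; ring⟩

/-- Exponential decay of the Fourier coefficients. -/
theorem MemP0.norm_fcoeff_le {ρ : ℝ} (hρ : 0 < ρ) {b : ℂ × ℂ → ℂ} (hb : MemP0 ρ b) (p q : ℤ) :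
    ‖fcoeff b p q‖ ≤ supNorm ρ b * Real.exp (-(|(p : ℝ)| + |(q : ℝ)|) * ρ) := by
  have key : ∀ r ∈ Set.Ico 0 ρ,
      ‖fcoeff b p q‖ ≤ supNorm ρ b * Real.exp (-(|(p : ℝ)| + |(q : ℝ)|) * r) := by
    rintro r ⟨hr0, hr⟩
    obtain ⟨σ, hσ, hpσ⟩ := exists_abs_eq_and_mul_eq_neg hr0 p
    obtain ⟨τ, hτ, hqτ⟩ := exists_abs_eq_and_mul_eq_neg hr0 (-q)
    rw [hb.fcoeff_eq_shift (hσ.trans_lt hr) (hτ.trans_lt hr), norm_mul]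
    have hin : ∀ x y : ℝ, ‖b ((x : ℂ) + σ * Complex.I, (y : ℂ) + τ * Complex.I) *
          efun (-p) (-q) ((x : ℂ) + σ * Complex.I, (y : ℂ) + τ * Complex.I)‖
        ≤ supNorm ρ b * Real.exp (-(|(p : ℝ)| + |(q : ℝ)|) * r) := by
      intro x y
      rw [norm_mul]
      refine mul_le_mul (hb.norm_le_supNorm ⟨?_, ?_⟩) ?_ (norm_nonneg _) (supNorm_nonneg _ _)
      · simpa [closedStrip] using (hσ.trans hr.le)
      · simpa [closedStrip] using (hτ.trans hr.le)
      · rw [norm_efun]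
        apply Real.exp_le_exp.2
        have e1 : ((x : ℂ) + σ * Complex.I).im = σ := by simp
        have e2 : ((y : ℂ) + τ * Complex.I).im = τ := by simp
        rw [abs_neg] at hqτ
        simp only [e1, e2]
        push_cast
        linarith
    have h2 := intervalIntegral.norm_integral_le_of_norm_le_const (a := 0) (b := 2 * Real.pi)
      (f := fun x : ℝ => ∫ y in (0 : ℝ)..(2 * Real.pi),
        b ((x : ℂ) + σ * Complex.I, (y : ℂ) + τ * Complex.I) *
          efun (-p) (-q) ((x : ℂ) + σ * Complex.I, (y : ℂ) + τ * Complex.I))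
      fun x _ => intervalIntegral.norm_integral_le_of_norm_le_const fun y _ => hin x y
    have hpi : 0 < 2 * Real.pi := by positivity
    rw [sub_zero, abs_of_pos hpi] at h2
    rw [Complex.norm_real, Real.norm_of_nonneg (by positivity), one_div,
      inv_mul_le_iff₀ (by positivity)]
    calc _ ≤ _ := h2
      _ = _ := by ring
  have hcont : Continuous fun r : ℝ =>
      supNorm ρ b * Real.exp (-(|(p : ℝ)| + |(q : ℝ)|) * r) := by fun_prop
  have hlim : Filter.Tendsto (fun r : ℝ =>
      supNorm ρ b * Real.exp (-(|(p : ℝ)| + |(q : ℝ)|) * r)) (nhdsWithin ρ (Set.Iio ρ))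
      (nhds (supNorm ρ b * Real.exp (-(|(p : ℝ)| + |(q : ℝ)|) * ρ))) :=
    (hcont.tendsto ρ).mono_left nhdsWithin_le_nhds
  refine ge_of_tendsto hlim ?_
  filter_upwards [Ico_mem_nhdsLT hρ] with r hr using key r hr

theorem norm_efun_le {r : ℝ} {z : ℂ × ℂ} (hz : z ∈ closedStrip r ×ˢ closedStrip r) (p q : ℤ) :
    ‖efun p q z‖ ≤ Real.exp ((|(p : ℝ)| + |(q : ℝ)|) * r) := by
  rw [norm_efun]
  apply Real.exp_le_exp.2
  have h1 : |(p : ℝ) * z.1.im| ≤ |(p : ℝ)| * r := by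
    rw [abs_mul]
    exact mul_le_mul_of_nonneg_left hz.1 (abs_nonneg _)
  have h2 : |(q : ℝ) * z.2.im| ≤ |(q : ℝ)| * r := by
    rw [abs_mul]
    exact mul_le_mul_of_nonneg_left hz.2 (abs_nonneg _)
  have h3 := neg_abs_le ((p : ℝ) * z.1.im)
  have h4 := le_abs_self ((q : ℝ) * z.2.im)
  linarith

theorem MemP0.conj_fcoeff {ρ : ℝ} {b : ℂ × ℂ → ℂ} (hb : MemP0 ρ b) (p q : ℤ) :
    (starRingEnd ℂ) (fcoeff b p q) = fcoeff b (-p) (-q) := by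
  have hreal : ∀ x y : ℝ, (starRingEnd ℂ) (b ((x : ℂ), (y : ℂ))) = b ((x : ℂ), (y : ℂ)) :=
    fun x y => Complex.conj_eq_iff_im.2 (hb.real_on_real x y)
  have hexp : ∀ x y : ℝ,
      (starRingEnd ℂ) (Complex.exp (-Complex.I * ((p : ℂ) * x - (q : ℂ) * y)))
        = Complex.exp (-Complex.I * (((-p : ℤ) : ℂ) * x - ((-q : ℤ) : ℂ) * y)) := by
    intro x y
    rw [← Complex.exp_conj]
    congr 1
    simp only [map_mul, map_sub, map_neg, Complex.conj_I, Complex.conj_ofReal, map_intCast]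
    push_cast
    ring
  unfold fcoeff
  rw [map_mul, Complex.conj_ofReal, ← intervalIntegral.intervalIntegral_conj]
  simp_rw [← intervalIntegral.intervalIntegral_conj, map_mul, hreal, hexp]

theorem MemP0.fcoeff_zero_zero {ρ : ℝ} {b : ℂ × ℂ → ℂ} (hb : MemP0 ρ b) : fcoeff b 0 0 = 0 := by
  simp [fcoeff, hb.zero_avg]

/-- The Fourier series of `b ∈ 𝒫₀(ρ)` converges to `b` wherever it is summable in the strip. -/
theorem MemP0.hasSum_fcoeff_mul_efun {ρ : ℝ} {b : ℂ × ℂ → ℂ} (hb : MemP0 ρ b) {z : ℂ × ℂ}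
    (hz : z ∈ openStrip ρ ×ˢ openStrip ρ)
    (hs : Summable fun pq : ℤ × ℤ => fcoeff b pq.1 pq.2 * efun pq.1 pq.2 z) :
    HasSum (fun pq : ℤ × ℤ => fcoeff b pq.1 pq.2 * efun pq.1 pq.2 z) (b z) := by
  obtain ⟨z, w⟩ := z
  have hz1 : |z.im| < ρ := hz.1
  have hz2 : |w.im| < ρ := hz.2
  set s : ℂ × ℂ := (z.im * Complex.I, w.im * Complex.I) with hsdef
  have hsplit : ∀ x y : ℝ, ((x : ℂ) + z.im * Complex.I, (y : ℂ) + w.im * Complex.I)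
      = ((x : ℂ), (y : ℂ)) + s := fun x y => by simp [hsdef]
  have hzs : (z, w) = ((z.re : ℂ), (w.re : ℂ)) + s := by
    rw [← hsplit, Complex.re_add_im, Complex.re_add_im]
  have hreal : ∀ (p q : ℤ) (x y : ℝ), efun p q ((x : ℂ), (y : ℂ))
      = Complex.exp (Complex.I * ((p : ℂ) * x - (q : ℂ) * y)) := fun p q x y => rfl
  have hterm : ∀ p q : ℤ, fcoeff b p q * efun p q (z, w) = fcoeff b p q * efun p q s *
      Complex.exp (Complex.I * ((p : ℂ) * z.re - (q : ℂ) * w.re)) := by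
    intro p q
    rw [hzs, efun_add, ← hreal]
    ring
  have hnorm : ∀ (p q : ℤ), ‖Complex.exp (Complex.I * ((p : ℂ) * z.re - (q : ℂ) * w.re))‖ = 1 := by
    intro p q
    rw [← hreal, norm_efun]
    simp
  have hcont : Continuous (Function.uncurry fun x y : ℝ =>
      b ((x : ℂ) + z.im * Complex.I, (y : ℂ) + w.im * Complex.I)) :=
    hb.contOn.comp_continuous
      (f := fun v : ℝ × ℝ => ((v.1 : ℂ) + z.im * Complex.I, (v.2 : ℂ) + w.im * Complex.I))
      (by fun_prop) fun v => ⟨by simpa [closedStrip] using hz1.le, by simpa [closedStrip] using hz2.le⟩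
  have key := hasSum_fourier_series_of_doubly_periodic
    (fun x y => b ((x : ℂ) + z.im * Complex.I, (y : ℂ) + w.im * Complex.I)) hcont
    (fun x y => by
      refine .trans ?_ (hb.periodic_fst ((x : ℂ) + z.im * Complex.I, (y : ℂ) + w.im * Complex.I))
      congr 2
      push_cast
      ring)
    (fun x y => by
      refine .trans ?_ (hb.periodic_snd ((x : ℂ) + z.im * Complex.I, (y : ℂ) + w.im * Complex.I))
      congr 2
      push_cast
      ring)
    (fun p q => fcoeff b p q * efun p q s)
    (fun p q => by
      rw [hb.fcoeff_eq_shift hz1 hz2]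
      simp_rw [hsplit, efun_add (-p) (-q), ← mul_assoc, intervalIntegral.integral_mul_const]
      rw [mul_assoc, mul_assoc _ _ (efun p q s), mul_comm (efun (-p) (-q) s), efun_mul_efun_neg,
        mul_one]
      simp_rw [efun_neg])
    (by
      refine Summable.of_norm (hs.norm.congr fun pq => ?_)
      rw [hterm, norm_mul _ (Complex.exp _), hnorm, mul_one])
    z.re w.re
  simp only [Complex.re_add_im] at key
  exact key.congr_fun fun pq => hterm pq.1 pq.2

theorem integral_exp_I_int_mul_eq_zero {n : ℤ} (hn : n ≠ 0) :
    ∫ x in (0 : ℝ)..(2 * Real.pi), Complex.exp (Complex.I * n * x) = 0 := by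
  have hc : Complex.I * (n : ℂ) ≠ 0 := mul_ne_zero Complex.I_ne_zero (by exact_mod_cast hn)
  rw [integral_exp_mul_complex hc]
  have h := exp_I_mul_int_mul_add_two_pi n 0 0
  simp only [zero_add, add_zero, ← mul_assoc] at h
  push_cast
  simp only [← mul_assoc] at h ⊢
  rw [h]
  simp

theorem integral_integral_efun_eq_zero {p q : ℤ} (hpq : (p, q) ≠ (0, 0)) :
    ∫ x in (0 : ℝ)..(2 * Real.pi), ∫ y in (0 : ℝ)..(2 * Real.pi), efun p q ((x : ℂ), (y : ℂ)) = 0 := by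
  have h : ∀ x y : ℝ, efun p q ((x : ℂ), (y : ℂ))
      = Complex.exp (Complex.I * p * x) * Complex.exp (Complex.I * (-q : ℤ) * y) := by
    intro x y
    rw [efun, ← Complex.exp_add]
    congr 1
    push_cast
    ring
  simp_rw [h, intervalIntegral.integral_const_mul, intervalIntegral.integral_mul_const]
  by_cases hp : p = 0
  · have hq : -q ≠ 0 := by
      rintro hq
      exact hpq (by rw [hp, neg_eq_zero.1 hq])
    rw [integral_exp_I_int_mul_eq_zero hq, mul_zero]
  · rw [integral_exp_I_int_mul_eq_zero hp, zero_mul]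

theorem hasSum_intervalIntegral_of_norm_le {ι : Type*} [Countable ι] {F : ι → ℝ → ℂ} {u : ι → ℝ}
    {s t : ℝ} (hF : ∀ i, Continuous (F i)) (hu : Summable u) (h : ∀ i x, ‖F i x‖ ≤ u i) :
    HasSum (fun i => ∫ x in s..t, F i x) (∫ x in s..t, ∑' i, F i x) := by
  refine intervalIntegral.hasSum_integral_of_dominated_convergence (fun i _ => u i)
    (fun i => (hF i).aestronglyMeasurable) (fun i => .of_forall fun x _ => h i x)
    (.of_forall fun _ _ => hu) intervalIntegrable_const (.of_forall fun x _ => ?_)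
  exact (Summable.of_norm_bounded hu fun i => h i x).hasSum

theorem integral_integral_tsum_mul_efun_eq_zero (k : {pq : ℤ × ℤ // pq ≠ (0, 0)} → ℂ)
    (u : {pq : ℤ × ℤ // pq ≠ (0, 0)} → ℝ) (hu : Summable u) (hk : ∀ i, ‖k i‖ ≤ u i) :
    ∫ x in (0 : ℝ)..(2 * Real.pi), ∫ y in (0 : ℝ)..(2 * Real.pi),
      ∑' i, k i * efun i.1.1 i.1.2 ((x : ℂ), (y : ℂ)) = 0 := by
  have hb : ∀ (i : {pq : ℤ × ℤ // pq ≠ (0, 0)}) (x y : ℝ),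
      ‖k i * efun i.1.1 i.1.2 ((x : ℂ), (y : ℂ))‖ ≤ u i := by
    intro i x y
    rw [norm_mul, norm_efun]
    simpa using hk i
  have hcont : ∀ i : {pq : ℤ × ℤ // pq ≠ (0, 0)}, Continuous (Function.uncurry fun x y : ℝ =>
      k i * efun i.1.1 i.1.2 ((x : ℂ), (y : ℂ))) := fun i =>
    continuous_const.mul ((continuous_efun _ _).comp (by fun_prop))
  have inner : ∀ x : ℝ, (∫ y in (0 : ℝ)..(2 * Real.pi),
      ∑' i, k i * efun i.1.1 i.1.2 ((x : ℂ), (y : ℂ)))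
      = ∑' i, ∫ y in (0 : ℝ)..(2 * Real.pi), k i * efun i.1.1 i.1.2 ((x : ℂ), (y : ℂ)) := by
    intro x
    exact (hasSum_intervalIntegral_of_norm_le
      (fun i => (hcont i).comp (Continuous.prodMk_right x)) hu fun i y => hb i x y).tsum_eq.symm
  simp_rw [inner]
  have outer := hasSum_intervalIntegral_of_norm_le (s := 0) (t := 2 * Real.pi)
    (F := fun (i : {pq : ℤ × ℤ // pq ≠ (0, 0)}) x =>
      ∫ y in (0 : ℝ)..(2 * Real.pi), k i * efun i.1.1 i.1.2 ((x : ℂ), (y : ℂ)))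
    (fun i => intervalIntegral.continuous_parametric_intervalIntegral_of_continuous' (hcont i) _ _)
    (hu.mul_right |2 * Real.pi - 0|)
    (fun i x => intervalIntegral.norm_integral_le_of_norm_le_const fun y _ => hb i x y)
  rw [← outer.tsum_eq]
  refine (tsum_congr fun i => ?_).trans tsum_zero
  simp_rw [intervalIntegral.integral_const_mul]
  rw [integral_integral_efun_eq_zero i.2, mul_zero]

theorem mul_exp_neg_mul_le {ε : ℝ} (hε : 0 < ε) (N : ℝ) : N * Real.exp (-N * ε) ≤ ε⁻¹ := by
  have h : N * ε ≤ Real.exp (N * ε) := (le_add_of_nonneg_right zero_le_one).trans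
    (Real.add_one_le_exp _)
  rw [neg_mul, Real.exp_neg, ← div_eq_mul_inv, div_le_iff₀ (Real.exp_pos _), inv_mul_eq_div,
    le_div_iff₀ hε]
  exact h

/-- convergence of the formal solution of the cohomological equation.
If `ser(δ) = Σ_{(p,q)≠(0,0)} e^{-(|p|+|q|)δ}/|qω-p|` is finite, then the Fourier series with
coefficients `a_{p,q}/(i(p-qω))` converges uniformly on the closed bi-strip of radius
`ρ-δ` to a function `g ∈ 𝒫₀(ρ-δ)` solving `(∂_x + ω∂_y) g = a` with
`‖g‖_{ρ-δ} ≤ ser(δ)·‖a‖_ρ`. -/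
theorem formal_solution_converges (ρ δ ω : ℝ) (hρ : 0 < ρ) (hδ0 : 0 < δ) (hδρ : δ < ρ)
    (hirr : Irrational ω) (hω0 : 0 < ω) (hω1 : ω < 1)
    (a : ℂ × ℂ → ℂ) (ha : MemP0 ρ a)
    (hser : Summable (fun pq : {pq : ℤ × ℤ // pq ≠ (0, 0)} =>
      Real.exp (-((|pq.1.1| + |pq.1.2| : ℤ) : ℝ) * δ) / |(pq.1.2 : ℝ) * ω - (pq.1.1 : ℝ)|)) :
    ∃ g : ℂ × ℂ → ℂ,
      TendstoUniformlyOn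
        (fun (s : Finset {pq : ℤ × ℤ // pq ≠ (0, 0)}) (z : ℂ × ℂ) =>
          ∑ pq ∈ s,
            fcoeff a pq.1.1 pq.1.2 / (Complex.I * ((pq.1.1 : ℂ) - (pq.1.2 : ℂ) * (ω : ℂ))) *
              efun pq.1.1 pq.1.2 z)
        g Filter.atTop (closedStrip (ρ - δ) ×ˢ closedStrip (ρ - δ)) ∧
      MemP0 (ρ - δ) g ∧
      (∀ z ∈ openStrip (ρ - δ) ×ˢ openStrip (ρ - δ), cohomOp ω g z = a z) ∧
      supNorm (ρ - δ) g ≤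
        (∑' pq : {pq : ℤ × ℤ // pq ≠ (0, 0)},
          Real.exp (-((|pq.1.1| + |pq.1.2| : ℤ) : ℝ) * δ) / |(pq.1.2 : ℝ) * ω - (pq.1.1 : ℝ)|) *
          supNorm ρ a := by
  set u : {pq : ℤ × ℤ // pq ≠ (0, 0)} → ℝ := fun pq =>
    Real.exp (-((|pq.1.1| + |pq.1.2| : ℤ) : ℝ) * δ) / |(pq.1.2 : ℝ) * ω - (pq.1.1 : ℝ)| with hu
  set k : {pq : ℤ × ℤ // pq ≠ (0, 0)} → ℂ := fun pq =>
    fcoeff a pq.1.1 pq.1.2 / (Complex.I * ((pq.1.1 : ℂ) - (pq.1.2 : ℂ) * (ω : ℂ))) with hkdef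
  set C := supNorm ρ a
  have hC0 : 0 ≤ C := supNorm_nonneg ρ a
  have hr0 : 0 < ρ - δ := sub_pos.2 hδρ
  have hucast : ∀ i, u i = Real.exp (-(|(i.1.1 : ℝ)| + |(i.1.2 : ℝ)|) * δ) /
      |(i.1.2 : ℝ) * ω - (i.1.1 : ℝ)| := by
    intro i
    simp only [hu]
    push_cast
    rfl
  have hu0 : ∀ i, 0 ≤ u i := fun i => by simp only [hu]; positivity
  have hdivisor : ∀ i : {pq : ℤ × ℤ // pq ≠ (0, 0)},
      (i.1.1 : ℂ) - (i.1.2 : ℂ) * (ω : ℂ) ≠ 0 := by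
    rintro ⟨⟨p, q⟩, hpq⟩ h
    have h' : (p : ℝ) - q * ω = 0 := by exact_mod_cast h
    by_cases hq : q = 0
    · subst hq
      apply hpq
      simp only [Int.cast_zero, zero_mul, sub_zero, Int.cast_eq_zero] at h'
      rw [h']
    · refine ((hirr.intCast_mul hq).ne_int p) ?_
      linarith
  have hknorm : ∀ i, ‖k i‖ ≤ C * (Real.exp (-(|(i.1.1 : ℝ)| + |(i.1.2 : ℝ)|) * ρ) /
      |(i.1.2 : ℝ) * ω - (i.1.1 : ℝ)|) := by
    intro i
    have e : ‖Complex.I * ((i.1.1 : ℂ) - (i.1.2 : ℂ) * (ω : ℂ))‖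
        = |(i.1.2 : ℝ) * ω - (i.1.1 : ℝ)| := by
      rw [norm_mul, Complex.norm_I, one_mul, abs_sub_comm, ← Real.norm_eq_abs, ← Complex.norm_real]
      push_cast
      rfl
    simp only [hkdef]
    rw [norm_div, e, ← mul_div_assoc]
    exact div_le_div_of_nonneg_right (ha.norm_fcoeff_le hρ _ _) (abs_nonneg _)
  have hterm : ∀ (r : ℝ), ∀ z ∈ closedStrip r ×ˢ closedStrip r, ∀ i,
      ‖k i * efun i.1.1 i.1.2 z‖ ≤
        C * (u i * Real.exp (-(|(i.1.1 : ℝ)| + |(i.1.2 : ℝ)|) * (ρ - δ - r))) := by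
    intro r z hz i
    rw [norm_mul]
    refine (mul_le_mul (hknorm i) (norm_efun_le hz _ _) (norm_nonneg _) (by positivity)).trans_eq ?_
    rw [hucast, mul_assoc, div_mul_eq_mul_div, div_mul_eq_mul_div, ← Real.exp_add, ← Real.exp_add]
    ring_nf
  have hbound : ∀ i, ∀ z ∈ closedStrip (ρ - δ) ×ˢ closedStrip (ρ - δ),
      ‖k i * efun i.1.1 i.1.2 z‖ ≤ C * u i := by
    intro i z hz
    simpa using hterm (ρ - δ) z hz i
  have huC : Summable fun i => C * u i := hser.mul_left C
  have hreal_mem : ∀ x : ℝ, (x : ℂ) ∈ closedStrip (ρ - δ) := fun x => by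
    simpa [closedStrip] using hr0.le
  have hderiv : ∀ z ∈ openStrip (ρ - δ) ×ˢ openStrip (ρ - δ),
      HasFDerivAt (fun z => ∑' i, k i * efun i.1.1 i.1.2 z)
        (∑' i : {pq : ℤ × ℤ // pq ≠ (0, 0)}, k i • (efun i.1.1 i.1.2 z • (Complex.I •
          ((i.1.1 : ℂ) • ContinuousLinearMap.fst ℂ ℂ ℂ
            - (i.1.2 : ℂ) • ContinuousLinearMap.snd ℂ ℂ ℂ)))) z ∧
      Summable fun i : {pq : ℤ × ℤ // pq ≠ (0, 0)} => k i • (efun i.1.1 i.1.2 z • (Complex.I •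
          ((i.1.1 : ℂ) • ContinuousLinearMap.fst ℂ ℂ ℂ
            - (i.1.2 : ℂ) • ContinuousLinearMap.snd ℂ ℂ ℂ))) := by
    intro z hz
    obtain ⟨r, hzr, hr⟩ := exists_between
      (max_lt (show |z.1.im| < ρ - δ from hz.1) (show |z.2.im| < ρ - δ from hz.2))
    have hε : 0 < ρ - δ - r := sub_pos.2 hr
    have hzr' : z ∈ openStrip r ×ˢ openStrip r :=
      ⟨(le_max_left _ _).trans_lt hzr, (le_max_right _ _).trans_lt hzr⟩
    have hf' : ∀ (i : {pq : ℤ × ℤ // pq ≠ (0, 0)}), ∀ w ∈ openStrip r ×ˢ openStrip r,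
        ‖k i • (efun i.1.1 i.1.2 w • (Complex.I • ((i.1.1 : ℂ) • ContinuousLinearMap.fst ℂ ℂ ℂ
            - (i.1.2 : ℂ) • ContinuousLinearMap.snd ℂ ℂ ℂ)))‖
          ≤ C * u i * (ρ - δ - r)⁻¹ := by
      intro i w hw
      have hL : ‖(i.1.1 : ℂ) • ContinuousLinearMap.fst ℂ ℂ ℂ
            - (i.1.2 : ℂ) • ContinuousLinearMap.snd ℂ ℂ ℂ‖ ≤ |(i.1.1 : ℝ)| + |(i.1.2 : ℝ)| := by
        refine (norm_sub_le _ _).trans (add_le_add ?_ ?_)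
        · rw [norm_smul, ContinuousLinearMap.norm_fst, mul_one, Complex.norm_intCast]
        · rw [norm_smul, ContinuousLinearMap.norm_snd, mul_one, Complex.norm_intCast]
      rw [smul_smul, norm_smul, norm_smul, Complex.norm_I, one_mul]
      have hw' : w ∈ closedStrip r ×ˢ closedStrip r :=
        ⟨openStrip_subset_closedStrip r hw.1, openStrip_subset_closedStrip r hw.2⟩
      calc _ ≤ C * (u i * Real.exp (-(|(i.1.1 : ℝ)| + |(i.1.2 : ℝ)|) * (ρ - δ - r))) *
            (|(i.1.1 : ℝ)| + |(i.1.2 : ℝ)|) :=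
            mul_le_mul (hterm r w hw' i) hL (norm_nonneg _)
              (mul_nonneg hC0 (mul_nonneg (hu0 i) (Real.exp_pos _).le))
        _ = C * u i * ((|(i.1.1 : ℝ)| + |(i.1.2 : ℝ)|) *
            Real.exp (-(|(i.1.1 : ℝ)| + |(i.1.2 : ℝ)|) * (ρ - δ - r))) := by ring
        _ ≤ _ := mul_le_mul_of_nonneg_left (mul_exp_neg_mul_le hε _) (mul_nonneg hC0 (hu0 i))
    have hsum := huC.mul_right (ρ - δ - r)⁻¹
    have hz' : z ∈ closedStrip (ρ - δ) ×ˢ closedStrip (ρ - δ) :=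
      ⟨openStrip_subset_closedStrip _ hz.1, openStrip_subset_closedStrip _ hz.2⟩
    refine ⟨?_, Summable.of_norm_bounded hsum fun i => hf' i z hzr'⟩
    exact hasFDerivAt_tsum_of_isPreconnected hsum ((isOpen_openStrip r).prod (isOpen_openStrip r))
      ((convex_openStrip r).prod (convex_openStrip r)).isPreconnected
      (fun i w _ => (hasFDerivAt_efun _ _ w).const_mul (k i)) hf' hzr'
      (Summable.of_norm_bounded huC fun i => hbound i z hz') hzr'
  refine ⟨fun z => ∑' i, k i * efun i.1.1 i.1.2 z, tendstoUniformlyOn_tsum huC hbound, ?_, ?_, ?_⟩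
  · refine ⟨?_, ?_, ?_, ?_, ?_, ?_⟩
    · exact continuousOn_tsum
        (fun i => (continuous_const.mul (continuous_efun _ _)).continuousOn) huC hbound
    · exact fun z hz => (hderiv z hz).1.differentiableAt.differentiableWithinAt
    · intro z
      simp only [efun_add_two_pi_fst]
    · intro z
      simp only [efun_add_two_pi_snd]
    · intro x y
      rw [← Complex.conj_eq_iff_im, Complex.conj_tsum]
      let e : {pq : ℤ × ℤ // pq ≠ (0, 0)} ≃ {pq : ℤ × ℤ // pq ≠ (0, 0)} :=
        (Equiv.neg (ℤ × ℤ)).subtypeEquiv fun pq => by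
          exact (neg_ne_zero (a := pq)).symm
      rw [← e.tsum_eq (fun i => k i * efun i.1.1 i.1.2 ((x : ℂ), (y : ℂ)))]
      refine tsum_congr fun i => ?_
      have he : (e i).1 = (-i.1.1, -i.1.2) := rfl
      simp only [hkdef, he, map_mul, map_div₀, ha.conj_fcoeff, efun, ← Complex.exp_conj, map_sub,
        Complex.conj_I, Complex.conj_ofReal, map_intCast]
      push_cast
      congr 2 <;> ring
    · refine integral_integral_tsum_mul_efun_eq_zero k _ huC fun i => ?_
      have h := hbound i (((0 : ℝ) : ℂ), ((0 : ℝ) : ℂ)) ⟨hreal_mem 0, hreal_mem 0⟩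
      simpa [efun] using h
  · intro z hz
    obtain ⟨hd, hs⟩ := hderiv z hz
    have hsum : HasSum (fun i : {pq : ℤ × ℤ // pq ≠ (0, 0)} =>
        fcoeff a i.1.1 i.1.2 * efun i.1.1 i.1.2 z)
        (cohomOp ω (fun z => ∑' i, k i * efun i.1.1 i.1.2 z) z) := by
      rw [cohomOp, hd.fderiv]
      have h1 := (ContinuousLinearMap.apply ℂ ℂ ((1 : ℂ), (0 : ℂ))).hasSum hs.hasSum
      have h2 := (ContinuousLinearMap.apply ℂ ℂ ((0 : ℂ), (1 : ℂ))).hasSum hs.hasSum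
      refine (h1.add (h2.mul_left (ω : ℂ))).congr_fun fun i => ?_
      have hne : Complex.I * ((i.1.1 : ℂ) - (i.1.2 : ℂ) * (ω : ℂ)) ≠ 0 :=
        mul_ne_zero Complex.I_ne_zero (hdivisor i)
      have hki : k i * (Complex.I * ((i.1.1 : ℂ) - (i.1.2 : ℂ) * (ω : ℂ)))
          = fcoeff a i.1.1 i.1.2 := div_mul_cancel₀ _ hne
      rw [← hki]
      simp
      ring
    have hsupp : Function.support (fun pq : ℤ × ℤ => fcoeff a pq.1 pq.2 * efun pq.1 pq.2 z)
        ⊆ {pq | pq ≠ (0, 0)} := by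
      rintro pq hpq rfl
      exact hpq (by simp [ha.fcoeff_zero_zero])
    have hsum' := (hasSum_subtype_iff_of_support_subset hsupp).1 hsum
    have hz' : z ∈ openStrip ρ ×ˢ openStrip ρ :=
      ⟨lt_trans hz.1 (sub_lt_self ρ hδ0), lt_trans hz.2 (sub_lt_self ρ hδ0)⟩
    exact hsum'.unique (ha.hasSum_fcoeff_mul_efun hz' hsum'.summable)
  · have hS := hser.hasSum.mul_left C
    refine Real.iSup_le (fun z => ?_) (mul_nonneg (tsum_nonneg hu0) hC0)
    rw [mul_comm]
    exact tsum_of_norm_bounded hS fun i => hbound i z z.2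
end

section
/- Let ω ∈ (0,1) be irrational and (C,τ)-Diophantine with C > 0 and τ ≥ 1, and let Δ ∈ (0, min(τ^{−1}, τ e^{−1})]. Then 𝔅rj₁(Δ) ≤ (C^{−1} (τ e^{−1})^τ / log φ) · Δ^{−τ} · ( log(Δ^{−1}) + log(3τφ) + Γ_Eul(τ)/(2 (τ e^{−1})^τ) ). -/
open Real
open scoped ENNReal

noncomputable section

/-- The Gauss-map iterates of `ω`. -/
def cfX (ω : ℝ) : ℕ → ℝ
  | 0 => ω
  | n + 1 => Int.fract (cfX ω n)⁻¹

/-- The partial quotients of `ω`: for `n ≥ 1`, `cfA ω n = ⌊1 / x_{n-1}⌋`. -/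
def cfA (ω : ℝ) : ℕ → ℕ
  | 0 => 0
  | n + 1 => (⌊(cfX ω n)⁻¹⌋).toNat

/-- Denominators of the convergents of `ω`. -/
def cfQ (ω : ℝ) : ℕ → ℕ
  | 0 => 1
  | 1 => cfA ω 1
  | n + 2 => cfA ω (n + 2) * cfQ ω (n + 1) + cfQ ω n

/-- First Brjuno-like function `𝔅rj₁(Δ) = Σ_{n=1}^∞ e^{-q_n Δ} q_{n+1}`, valued in `[0,∞]`. -/
def Brj1 (ω Δ : ℝ) : ℝ≥0∞ :=
  ∑' n : ℕ, ENNReal.ofReal (Real.exp (-(cfQ ω (n + 1) : ℝ) * Δ) * (cfQ ω (n + 2) : ℝ))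

/-- `ω` is `(C,τ)`-Diophantine: `|qω - p| ≥ C/|q|^τ` for all integers `p`, `q ≠ 0`. -/
def IsDiophantine (C τ ω : ℝ) : Prop :=
  ∀ p q : ℤ, q ≠ 0 → C / |(q : ℝ)| ^ τ ≤ |(q : ℝ) * ω - (p : ℝ)|

/-- The golden ratio `φ = (1+√5)/2`. -/
def goldenφ : ℝ := (1 + Real.sqrt 5) / 2

end

/-! ### Growth of the denominators -/

lemma cfX_irrational {ω : ℝ} (hirr : Irrational ω) (n : ℕ) : Irrational (cfX ω n) := by
  induction n with
  | zero => exact hirr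
  | succ n ih =>
    rw [cfX, Int.fract]
    exact (irrational_inv_iff.2 ih).sub_intCast _

lemma cfX_pos {ω : ℝ} (hirr : Irrational ω) (hω0 : 0 < ω) (n : ℕ) : 0 < cfX ω n := by
  cases n with
  | zero => exact hω0
  | succ n =>
    exact lt_of_le_of_ne (Int.fract_nonneg _) (cfX_irrational hirr (n + 1)).ne_zero.symm

lemma cfX_lt_one {ω : ℝ} (hω1 : ω < 1) (n : ℕ) : cfX ω n < 1 := by
  cases n with
  | zero => exact hω1
  | succ n => exact Int.fract_lt_one _

lemma one_le_cfA_succ {ω : ℝ} (hirr : Irrational ω) (hω0 : 0 < ω) (hω1 : ω < 1) (n : ℕ) :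
    1 ≤ cfA ω (n + 1) := by
  have h : (1 : ℤ) ≤ ⌊(cfX ω n)⁻¹⌋ := by
    rw [Int.le_floor, Int.cast_one]
    exact (one_lt_inv₀ (cfX_pos hirr hω0 n)).2 (cfX_lt_one hω1 n) |>.le
  rw [cfA]
  omega

lemma cfA_add_cfX {ω : ℝ} (hirr : Irrational ω) (hω0 : 0 < ω) (n : ℕ) :
    (cfA ω (n + 1) : ℝ) + cfX ω (n + 1) = (cfX ω n)⁻¹ := by
  have h : (0 : ℤ) ≤ ⌊(cfX ω n)⁻¹⌋ :=
    Int.floor_nonneg.2 (inv_pos.2 (cfX_pos hirr hω0 n)).le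
  have h' : (cfA ω (n + 1) : ℝ) = (⌊(cfX ω n)⁻¹⌋ : ℝ) := by
    rw [cfA]
    exact_mod_cast congrArg (Int.cast : ℤ → ℝ) (Int.toNat_of_nonneg h)
  rw [h', cfX, Int.floor_add_fract]

lemma cfX_mul_cfX_succ {ω : ℝ} (hirr : Irrational ω) (hω0 : 0 < ω) (n : ℕ) :
    cfX ω n * cfX ω (n + 1) = 1 - cfA ω (n + 1) * cfX ω n := by
  have h := cfA_add_cfX hirr hω0 n
  have h' := mul_inv_cancel₀ (cfX_pos hirr hω0 n).ne'
  rw [← h] at h'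
  linarith

lemma cfQ_add_le {ω : ℝ} (hirr : Irrational ω) (hω0 : 0 < ω) (hω1 : ω < 1) (n : ℕ) :
    cfQ ω (n + 1) + cfQ ω n ≤ cfQ ω (n + 2) := by
  rw [cfQ]
  nlinarith [one_le_cfA_succ hirr hω0 hω1 (n + 1)]

lemma one_le_cfQ {ω : ℝ} (hirr : Irrational ω) (hω0 : 0 < ω) (hω1 : ω < 1) (n : ℕ) :
    1 ≤ cfQ ω n ∧ 1 ≤ cfQ ω (n + 1) := by
  induction n with
  | zero => exact ⟨le_rfl, one_le_cfA_succ hirr hω0 hω1 0⟩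
  | succ n ih => exact ⟨ih.2, ih.2.trans (le_trans (Nat.le_add_right _ _) (cfQ_add_le hirr hω0 hω1 n))⟩

lemma goldenRatio_pow_le_cfQ {ω : ℝ} (hirr : Irrational ω) (hω0 : 0 < ω) (hω1 : ω < 1) (n : ℕ) :
    goldenRatio ^ n ≤ (cfQ ω (n + 1) : ℝ) ∧ goldenRatio ^ (n + 1) ≤ (cfQ ω (n + 2) : ℝ) := by
  have hq := one_le_cfQ hirr hω0 hω1
  induction n with
  | zero =>
    have h2 : 2 ≤ cfQ ω 2 := by
      have := cfQ_add_le hirr hω0 hω1 0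
      have := hq 0
      simp only [zero_add] at *
      omega
    have h2' : (2 : ℝ) ≤ cfQ ω 2 := by exact_mod_cast h2
    refine ⟨by simpa using (hq 0).2, ?_⟩
    simpa using goldenRatio_lt_two.le.trans h2'
  | succ n ih =>
    refine ⟨ih.2, ?_⟩
    have h : (cfQ ω (n + 2) : ℝ) + cfQ ω (n + 1) ≤ cfQ ω (n + 3) := by
      exact_mod_cast cfQ_add_le hirr hω0 hω1 (n + 1)
    calc goldenRatio ^ (n + 1 + 1) = goldenRatio ^ n * goldenRatio ^ 2 := by ring
      _ = goldenRatio ^ (n + 1) + goldenRatio ^ n := by rw [goldenRatio_sq]; ring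
      _ ≤ _ := by linarith [ih.1, ih.2]

lemma fib_mul_cfQ_le {ω : ℝ} (hirr : Irrational ω) (hω0 : 0 < ω) (hω1 : ω < 1) (n j : ℕ) :
    Nat.fib (j + 1) * cfQ ω (n + 1) ≤ cfQ ω (n + 1 + j) ∧
      Nat.fib (j + 2) * cfQ ω (n + 1) ≤ cfQ ω (n + 2 + j) := by
  induction j with
  | zero =>
    have := cfQ_add_le hirr hω0 hω1 n
    simp
    omega
  | succ j ih =>
    refine ⟨by simpa [add_comm, add_left_comm, add_assoc] using ih.2, ?_⟩
    have h := cfQ_add_le hirr hω0 hω1 (n + 1 + j)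
    rw [show j + 1 + 2 = (j + 1) + 2 from rfl, Nat.fib_add_two, add_mul]
    have e1 : n + 1 + j + 1 = n + 2 + j := by ring
    have e2 : n + 1 + j + 2 = n + 2 + (j + 1) := by ring
    rw [e1, e2] at h
    have := ih.1
    have := ih.2
    rw [show j + 1 + 1 = j + 2 from rfl]
    omega

/-! ### Approximation by convergents -/

lemma cfQ_mul_sub_eq_prod {ω : ℝ} (hirr : Irrational ω) (hω0 : 0 < ω) (n : ℕ) :
    ∃ p p' : ℤ,
      (cfQ ω n : ℝ) * ω - p = (-1) ^ n * ∏ i ∈ Finset.range (n + 1), cfX ω i ∧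
      (cfQ ω (n + 1) : ℝ) * ω - p' = (-1) ^ (n + 1) * ∏ i ∈ Finset.range (n + 2), cfX ω i := by
  induction n with
  | zero =>
    refine ⟨0, 1, by simp [cfQ, cfX], ?_⟩
    have h := cfX_mul_cfX_succ hirr hω0 0
    simp only [cfX, zero_add] at h
    simp [cfQ, Finset.prod_range_succ, cfX]
    linarith
  | succ n ih =>
    obtain ⟨p, p', h, h'⟩ := ih
    refine ⟨p', cfA ω (n + 2) * p' + p, h', ?_⟩
    have hx := cfX_mul_cfX_succ hirr hω0 (n + 1)
    rw [Finset.prod_range_succ] at h'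
    rw [cfQ, Finset.prod_range_succ, Finset.prod_range_succ]
    push_cast
    simp only [pow_succ] at *
    linear_combination (cfA ω (n + 2) : ℝ) * h' + h
      - (-1) ^ n * (∏ i ∈ Finset.range (n + 1), cfX ω i) * hx

lemma prod_cfX_mul_cfQ_add {ω : ℝ} (hirr : Irrational ω) (hω0 : 0 < ω) (n : ℕ) :
    (∏ i ∈ Finset.range (n + 1), cfX ω i) * cfQ ω (n + 1) +
      (∏ i ∈ Finset.range (n + 2), cfX ω i) * cfQ ω n = 1 := by
  induction n with
  | zero =>
    have h := cfX_mul_cfX_succ hirr hω0 0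
    simp [cfQ, Finset.prod_range_succ] at h ⊢
    linarith
  | succ n ih =>
    have hx := cfX_mul_cfX_succ hirr hω0 (n + 1)
    rw [Finset.prod_range_succ _ (n + 1)] at ih
    rw [cfQ, Finset.prod_range_succ _ (n + 2), Finset.prod_range_succ _ (n + 1)]
    push_cast
    linear_combination ih
      + (∏ i ∈ Finset.range (n + 1), cfX ω i) * cfQ ω (n + 1) * hx

lemma cfQ_succ_le_of_isDiophantine {ω C τ : ℝ} (hirr : Irrational ω) (hω0 : 0 < ω) (hω1 : ω < 1)
    (hC : 0 < C) (hdio : IsDiophantine C τ ω) (n : ℕ) :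
    (cfQ ω (n + 1) : ℝ) ≤ C⁻¹ * (cfQ ω n : ℝ) ^ τ := by
  obtain ⟨p, -, hp, -⟩ := cfQ_mul_sub_eq_prod hirr hω0 n
  have hpos : ∀ m, 0 < ∏ i ∈ Finset.range m, cfX ω i :=
    fun m => Finset.prod_pos fun i _ => cfX_pos hirr hω0 i
  have hq : 1 ≤ cfQ ω n := (one_le_cfQ hirr hω0 hω1 n).1
  have hq0 : (0 : ℝ) < cfQ ω n := by exact_mod_cast hq
  have hd := hdio p (cfQ ω n) (by omega)
  simp only [Int.cast_natCast] at hd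
  rw [hp, abs_mul, abs_pow, abs_neg, abs_one, one_pow, one_mul, abs_of_pos (hpos _),
    abs_of_pos hq0, div_le_iff₀ (rpow_pos_of_pos hq0 τ)] at hd
  have h1 : (∏ i ∈ Finset.range (n + 1), cfX ω i) * cfQ ω (n + 1) ≤ 1 := by
    have := prod_cfX_mul_cfQ_add hirr hω0 n
    have := mul_pos (hpos (n + 2)) hq0
    linarith
  rw [inv_mul_eq_div, le_div_iff₀ hC]
  calc (cfQ ω (n + 1) : ℝ) * C
      ≤ cfQ ω (n + 1) * ((∏ i ∈ Finset.range (n + 1), cfX ω i) * (cfQ ω n : ℝ) ^ τ) := by gcongr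
    _ = ((∏ i ∈ Finset.range (n + 1), cfX ω i) * cfQ ω (n + 1)) * (cfQ ω n : ℝ) ^ τ := by ring
    _ ≤ 1 * (cfQ ω n : ℝ) ^ τ := by gcongr
    _ = _ := one_mul _

/-! ### A lower bound for the Gamma function -/

lemma two_mul_rpow_le_mul_Gamma {τ : ℝ} (hτ : 1 ≤ τ) :
    2 * (τ * exp (-1)) ^ τ ≤ τ * Gamma τ := by
  have hτ0 : 0 < τ := by linarith
  have hderiv : ∀ x ∈ Set.Ici τ, HasDerivAt (fun x => -(τ ^ τ * (exp (-x) * (2 + x - τ))))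
      (τ ^ τ * (exp (-x) * (1 + x - τ))) x := by
    intro x _
    have h1 : HasDerivAt (fun x : ℝ => exp (-x)) (-exp (-x)) x := by
      simpa using (hasDerivAt_neg x).exp
    have h2 : HasDerivAt (fun x : ℝ => 2 + x - τ) 1 x :=
      ((hasDerivAt_id x).const_add 2).sub_const τ
    refine ((h1.mul h2).const_mul (τ ^ τ)).neg.congr_deriv ?_
    ring
  have hnonneg : ∀ x ∈ Set.Ioi τ, 0 ≤ τ ^ τ * (exp (-x) * (1 + x - τ)) := by
    intro x hx
    have : 0 ≤ 1 + x - τ := by linarith [Set.mem_Ioi.1 hx]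
    positivity
  have hlim : Filter.Tendsto (fun x => -(τ ^ τ * (exp (-x) * (2 + x - τ)))) Filter.atTop
      (nhds 0) := by
    have h1 : Filter.Tendsto (fun x : ℝ => x * exp (-x)) Filter.atTop (nhds 0) := by
      simpa using tendsto_pow_mul_exp_neg_atTop_nhds_zero 1
    have h2 : Filter.Tendsto (fun x : ℝ => exp (-x)) Filter.atTop (nhds 0) :=
      tendsto_exp_neg_atTop_nhds_zero
    have h3 := ((h1.add (h2.const_mul (2 - τ))).const_mul (τ ^ τ)).neg
    simp only [mul_zero, add_zero, neg_zero] at h3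
    refine h3.congr fun x => ?_
    ring
  have hint := MeasureTheory.integrableOn_Ioi_deriv_of_nonneg' hderiv hnonneg hlim
  have hval := MeasureTheory.integral_Ioi_of_hasDerivAt_of_nonneg' hderiv hnonneg hlim
  have hG : MeasureTheory.IntegrableOn (fun x => exp (-x) * x ^ τ) (Set.Ioi 0) := by
    simpa using GammaIntegral_convergent (s := τ + 1) (by linarith)
  have hsub : Set.Ioi τ ⊆ Set.Ioi (0 : ℝ) := Set.Ioi_subset_Ioi hτ0.le
  calc 2 * (τ * exp (-1)) ^ τ = ∫ x in Set.Ioi τ, τ ^ τ * (exp (-x) * (1 + x - τ)) := by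
        rw [hval, mul_rpow hτ0.le (exp_pos _).le, ← exp_mul]
        simp only [neg_mul, one_mul]
        ring
    _ ≤ ∫ x in Set.Ioi τ, exp (-x) * x ^ τ := by
        refine MeasureTheory.setIntegral_mono_on hint (hG.mono_set hsub) measurableSet_Ioi ?_
        intro x hx
        have hx' : τ < x := hx
        have hb : 1 + τ * ((x - τ) / τ) ≤ (1 + (x - τ) / τ) ^ τ :=
          one_add_mul_self_le_rpow_one_add (by
            have : 0 ≤ (x - τ) / τ := div_nonneg (by linarith) hτ0.le
            linarith) hτ
        have e1 : 1 + τ * ((x - τ) / τ) = 1 + x - τ := by field_simp; ring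
        have e2 : 1 + (x - τ) / τ = x / τ := by field_simp; ring
        rw [e1, e2, div_rpow (by linarith) hτ0.le, le_div_iff₀ (rpow_pos_of_pos hτ0 τ)] at hb
        calc τ ^ τ * (exp (-x) * (1 + x - τ)) = exp (-x) * ((1 + x - τ) * τ ^ τ) := by ring
          _ ≤ _ := by gcongr
    _ ≤ ∫ x in Set.Ioi 0, exp (-x) * x ^ τ := by
        refine MeasureTheory.setIntegral_mono_set hG ?_ hsub.eventuallyLE
        refine (MeasureTheory.ae_restrict_iff' measurableSet_Ioi).2 (.of_forall fun x hx => ?_)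
        have : (0 : ℝ) < x := hx
        simp only [Pi.zero_apply]
        positivity
    _ = τ * Gamma τ := by
        rw [← Gamma_add_one hτ0.ne', Gamma_eq_integral (by linarith)]
        simp

/-! ### The profile `x ↦ x ^ τ * exp (-x * Δ)` -/

lemma mul_exp_one_sub_anti {m t : ℝ} (hm : 1 ≤ m) (hmt : m ≤ t) :
    t * exp (1 - t) ≤ m * exp (1 - m) := by
  have h1 : t ≤ m * exp (t - m) := by
    have := add_one_le_exp (t - m)
    nlinarith
  calc t * exp (1 - t) ≤ m * exp (t - m) * exp (1 - t) := by gcongr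
    _ = m * exp (1 - m) := by
        rw [mul_assoc, ← exp_add]
        congr 2
        ring

lemma mul_exp_one_sub_le_one (t : ℝ) : t * exp (1 - t) ≤ 1 := by
  have h := add_one_le_exp (t - 1)
  calc t * exp (1 - t) ≤ exp (t - 1) * exp (1 - t) := by gcongr; linarith
    _ = 1 := by rw [← exp_add]; simp

lemma exp_neg_mul_rpow_eq {τ Δ x : ℝ} (hτ : 0 < τ) (hΔ : 0 < Δ) (hx : 0 ≤ x) :
    exp (-x * Δ) * x ^ τ = (τ * exp (-1)) ^ τ * Δ ^ (-τ) *
      ((x * Δ / τ) * exp (1 - x * Δ / τ)) ^ τ := by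
  have hexp : exp (-x * Δ) = (exp (-(x * Δ / τ))) ^ τ := by
    rw [← exp_mul]
    congr 1
    field_simp
  rw [hexp, rpow_neg hΔ.le, ← inv_rpow hΔ.le, ← mul_rpow (by positivity) (by positivity),
    ← mul_rpow (by positivity) (by positivity), ← mul_rpow (by positivity) (by positivity)]
  congr 1
  rw [sub_eq_add_neg, exp_add, exp_neg 1]
  field_simp

lemma exp_neg_mul_rpow_le {τ Δ x : ℝ} (hτ : 0 < τ) (hΔ : 0 < Δ) (hx : 0 ≤ x) :
    exp (-x * Δ) * x ^ τ ≤ (τ * exp (-1)) ^ τ * Δ ^ (-τ) := by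
  rw [exp_neg_mul_rpow_eq hτ hΔ hx]
  refine mul_le_of_le_one_right (by positivity) ?_
  exact rpow_le_one (by positivity) (mul_exp_one_sub_le_one _) hτ.le

lemma exp_neg_mul_rpow_le_of_le {τ Δ x m : ℝ} (hτ : 0 < τ) (hΔ : 0 < Δ) (hm : 1 ≤ m)
    (hx : m * (τ / Δ) ≤ x) :
    exp (-x * Δ) * x ^ τ ≤ (τ * exp (-1)) ^ τ * Δ ^ (-τ) * (m * exp (1 - m)) ^ τ := by
  have hx0 : 0 ≤ x := le_trans (by positivity) hx
  rw [exp_neg_mul_rpow_eq hτ hΔ hx0]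
  have ht : m ≤ x * Δ / τ := by
    rw [le_div_iff₀ hτ]
    calc m * τ = m * (τ / Δ) * Δ := by field_simp
      _ ≤ x * Δ := by gcongr
  refine mul_le_mul_of_nonneg_left ?_ (by positivity)
  exact rpow_le_rpow (by positivity) (mul_exp_one_sub_anti hm ht) hτ.le

lemma mul_exp_neg_mul_le_s2 {τ L : ℝ} (hL : 0 < L) : τ * exp (-L) ^ τ ≤ (exp 1 * L)⁻¹ := by
  have h := add_one_le_exp (τ * L - 1)
  rw [← exp_mul, inv_eq_one_div, le_div_iff₀ (by positivity)]
  calc τ * exp (-L * τ) * (exp 1 * L) = (τ * L) * exp (1 - τ * L) := by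
        rw [sub_eq_add_neg, exp_add, show -(τ * L) = -L * τ by ring]
        ring
    _ ≤ 1 := mul_exp_one_sub_le_one _

lemma mul_rpow_le_self {τ r : ℝ} (hτ : 1 ≤ τ) (hr0 : 0 < r) (hr : r ≤ exp (-1)) :
    τ * r ^ τ ≤ r := by
  have h : τ * r ^ (τ - 1) ≤ 1 :=
    calc τ * r ^ (τ - 1) ≤ τ * exp (-1) ^ (τ - 1) := by gcongr
      _ = τ * exp (1 - τ) := by
          rw [← exp_mul]
          congr 2
          ring
      _ ≤ 1 := mul_exp_one_sub_le_one τ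
  calc τ * r ^ τ = τ * r ^ (τ - 1) * r := by
        rw [mul_assoc, ← rpow_add_one hr0.ne', sub_add_cancel]
    _ ≤ 1 * r := by gcongr
    _ = r := one_mul r

/-! ### Summing the profile along Fibonacci numbers -/

lemma mul_two_mul_exp_rpow_le (τ : ℝ) : τ * ((2 : ℝ) * exp (1 - 2)) ^ τ ≤ 1.21 := by
  have hlog := log_two_lt_d9
  have he := exp_one_gt_d9
  have h := mul_exp_neg_mul_le_s2 (τ := τ) (L := 1 - log 2) (by linarith)
  have e : exp (-(1 - log 2)) = 2 * exp (1 - 2) := by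
    rw [show -(1 - log 2) = log 2 + (1 - 2) by ring, exp_add, exp_log two_pos]
  rw [e] at h
  refine h.trans (inv_le_of_inv_le₀ (by norm_num) ?_)
  have : (2.718 : ℝ) * 0.306 ≤ exp 1 * (1 - log 2) := by gcongr <;> linarith
  norm_num at this ⊢
  linarith

lemma mul_three_mul_exp_rpow_le (τ : ℝ) : τ * ((3 : ℝ) * exp (1 - 3)) ^ τ ≤ 0.5 := by
  have he := exp_one_gt_d9
  have hlog : log 3 ≤ 1.2 := by
    have h1 := log_two_lt_d9
    have h2 := log_le_sub_one_of_pos (x := 3 / 2) (by norm_num)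
    have h3 : log 3 = log 2 + log (3 / 2) := by
      rw [← log_mul (by norm_num) (by norm_num)]
      norm_num
    linarith
  have h := mul_exp_neg_mul_le_s2 (τ := τ) (L := 2 - log 3) (by linarith)
  have e : exp (-(2 - log 3)) = 3 * exp (1 - 3) := by
    rw [show -(2 - log 3) = log 3 + (1 - 3) by ring, exp_add, exp_log (by norm_num)]
  rw [e] at h
  refine h.trans (inv_le_of_inv_le₀ (by norm_num) ?_)
  have : (2.718 : ℝ) * 0.8 ≤ exp 1 * (2 - log 3) := by gcongr <;> linarith
  norm_num at this ⊢
  linarith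

lemma exp_neg_four_le : 5 * exp (-4) ≤ 0.1 := by
  have he := exp_one_gt_d9
  have h4 : exp 4 = exp 1 ^ 4 := by rw [← exp_nat_mul]; norm_num
  have h : (2.7 : ℝ) ^ 4 ≤ exp 4 := by rw [h4]; gcongr; linarith
  rw [exp_neg, ← div_eq_mul_inv, div_le_iff₀ (exp_pos 4)]
  norm_num at h ⊢
  linarith

lemma mul_exp_one_sub_le_geometric (j : ℕ) :
    ((j : ℝ) + 5) * exp (1 - ((j : ℝ) + 5)) ≤ 0.1 * (1 / 2) ^ j := by
  induction j with
  | zero =>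
    have := exp_neg_four_le
    norm_num at this ⊢
    exact this
  | succ j ih =>
    have he := exp_one_gt_d9
    have hj : (0 : ℝ) ≤ j := j.cast_nonneg
    have h1 : exp (-1) ≤ 0.4 := by
      rw [exp_neg]
      exact inv_le_of_inv_le₀ (by norm_num) (by norm_num; linarith)
    have e : exp (1 - (((j + 1 : ℕ) : ℝ) + 5)) = exp (1 - ((j : ℝ) + 5)) * exp (-1) := by
      rw [← exp_add]
      push_cast
      congr 1
      ring
    rw [e, pow_succ]
    push_cast
    have hE := exp_pos (1 - ((j : ℝ) + 5))
    calc ((j : ℝ) + 1 + 5) * (exp (1 - ((j : ℝ) + 5)) * exp (-1))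
        ≤ ((j : ℝ) + 1 + 5) * (exp (1 - ((j : ℝ) + 5)) * 0.4) := by gcongr
      _ ≤ ((j : ℝ) + 5) * exp (1 - ((j : ℝ) + 5)) * (1 / 2) := by nlinarith
      _ ≤ 0.1 * (1 / 2) ^ j * (1 / 2) := by gcongr
      _ = _ := by ring

lemma mul_fib_mul_exp_rpow_le {τ : ℝ} (hτ : 1 ≤ τ) (j : ℕ) :
    τ * ((Nat.fib (j + 5) : ℝ) * exp (1 - Nat.fib (j + 5))) ^ τ ≤ 0.1 * (1 / 2) ^ j := by
  have hfib : (j : ℝ) + 5 ≤ Nat.fib (j + 5) := by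
    exact_mod_cast Nat.le_fib_self (n := j + 5) (by omega)
  have hj : (0 : ℝ) ≤ j := j.cast_nonneg
  have h := (mul_exp_one_sub_anti (by linarith) hfib).trans (mul_exp_one_sub_le_geometric j)
  refine (mul_rpow_le_self hτ ?_ ?_).trans h
  · have : (0 : ℝ) < Nat.fib (j + 5) := by linarith
    positivity
  · have h2 : (0.1 : ℝ) * (1 / 2) ^ j ≤ 0.1 :=
      mul_le_of_le_one_right (by norm_num) (pow_le_one₀ (by norm_num) (by norm_num))
    have h3 : (0.3 : ℝ) ≤ exp (-1) := by
      have := exp_one_lt_d9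
      rw [exp_neg]
      exact le_inv_of_le_inv₀ (exp_pos 1) (by norm_num; linarith)
    linarith

lemma sum_fib_mul_exp_rpow_le {τ : ℝ} (hτ : 1 ≤ τ) (n : ℕ) :
    ∑ j ∈ Finset.range n, ((Nat.fib (j + 3) : ℝ) * exp (1 - Nat.fib (j + 3))) ^ τ ≤ 2 / τ := by
  have hτ0 : 0 < τ := by linarith
  rw [le_div_iff₀ hτ0, mul_comm, Finset.mul_sum]
  have hgeom : ∑ j ∈ Finset.range n, (0.1 : ℝ) * (1 / 2) ^ j ≤ 0.2 := by
    rw [← Finset.mul_sum, geom_sum_eq (by norm_num)]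
    have : (0 : ℝ) ≤ (1 / 2) ^ n := by positivity
    norm_num
    linarith
  calc ∑ j ∈ Finset.range n, τ * ((Nat.fib (j + 3) : ℝ) * exp (1 - Nat.fib (j + 3))) ^ τ
      ≤ ∑ j ∈ Finset.range (n + 2),
          τ * ((Nat.fib (j + 3) : ℝ) * exp (1 - Nat.fib (j + 3))) ^ τ := by
        refine Finset.sum_le_sum_of_subset_of_nonneg
          (Finset.range_subset_range.2 (Nat.le_add_right n 2)) fun j _ _ => by positivity
    _ ≤ ∑ j ∈ Finset.range n, (0.1 : ℝ) * (1 / 2) ^ j + 0.5 + 1.21 := by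
        rw [Finset.sum_range_succ', Finset.sum_range_succ']
        refine add_le_add (add_le_add (Finset.sum_le_sum fun j _ => ?_) ?_) ?_
        · exact mul_fib_mul_exp_rpow_le hτ j
        · exact mul_three_mul_exp_rpow_le τ
        · exact mul_two_mul_exp_rpow_le τ
    _ ≤ 2 := by linarith

/-! ### Summing the profile along the denominators -/

lemma log_goldenφ_pos : 0 < log goldenφ := log_pos one_lt_goldenRatio

lemma log_goldenφ_le_half : log goldenφ ≤ 1 / 2 := by
  have h : goldenφ ^ 2 ≤ exp 1 := by
    have h1 : goldenφ ^ 2 = goldenφ + 1 := goldenRatio_sq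
    have h2 : goldenφ ≤ 1.7 := by
      have : sqrt 5 ≤ 2.4 := sqrt_le_iff.2 (by norm_num)
      rw [goldenφ]
      linarith
    linarith [exp_one_gt_d9]
  have h' := (log_le_iff_le_exp (pow_pos goldenRatio_pos 2)).2 h
  rw [log_pow] at h'
  have h2 : (2 : ℝ) * log goldenφ ≤ 1 := h'
  linarith

lemma two_mul_log_goldenφ_le : 2 * log goldenφ ≤ log 3 := by
  have h : goldenφ ^ 2 ≤ 3 := by
    have h1 : goldenφ ^ 2 = goldenφ + 1 := goldenRatio_sq
    have h2 : goldenφ < 2 := goldenRatio_lt_two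
    linarith
  have h' := log_le_log (pow_pos goldenRatio_pos 2) h
  rw [log_pow] at h'
  exact_mod_cast h'

lemma exists_cfQ_crossing {ω Q : ℝ} (hirr : Irrational ω) (hω0 : 0 < ω) (hω1 : ω < 1)
    (hQ : 1 ≤ Q) :
    ∃ N : ℕ, Q ≤ cfQ ω (N + 1) ∧ (N : ℝ) * log goldenφ ≤ log goldenφ + log Q := by
  classical
  have hgrow := goldenRatio_pow_le_cfQ hirr hω0 hω1
  have hex : ∃ N : ℕ, Q ≤ cfQ ω (N + 1) := by
    obtain ⟨n, hn⟩ := pow_unbounded_of_one_lt Q one_lt_goldenRatio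
    exact ⟨n, hn.le.trans (hgrow n).1⟩
  refine ⟨Nat.find hex, Nat.find_spec hex, ?_⟩
  rcases h : Nat.find hex with _ | k
  · have := log_nonneg hQ
    have := log_goldenφ_pos
    simp
    linarith
  · have hk : (cfQ ω (k + 1) : ℝ) < Q := not_le.1 (Nat.find_min hex (by omega))
    have h1 := log_le_log (pow_pos goldenRatio_pos k) ((hgrow k).1.trans hk.le)
    rw [log_pow] at h1
    have h2 : (k : ℝ) * log goldenφ ≤ log Q := h1
    push_cast
    linarith

lemma sum_exp_mul_cfQ_rpow_le {ω τ Δ : ℝ} (hirr : Irrational ω) (hω0 : 0 < ω) (hω1 : ω < 1)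
    (hτ : 1 ≤ τ) (hΔ : 0 < Δ) {N : ℕ} (hN : τ / Δ ≤ cfQ ω (N + 1)) (n : ℕ) :
    ∑ i ∈ Finset.range n, exp (-(cfQ ω (i + 1) : ℝ) * Δ) * (cfQ ω (i + 1) : ℝ) ^ τ ≤
      (τ * exp (-1)) ^ τ * Δ ^ (-τ) * (N + 2 + 2 / τ) := by
  have hτ0 : 0 < τ := by linarith
  have htail (j : ℕ) : (Nat.fib (j + 3) : ℝ) * (τ / Δ) ≤ cfQ ω (N + 2 + j + 1) := by
    have h : ((Nat.fib (j + 3) * cfQ ω (N + 1) : ℕ) : ℝ) ≤ cfQ ω (N + 2 + j + 1) := by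
      have := (fib_mul_cfQ_le hirr hω0 hω1 N (j + 1)).2
      rw [show N + 2 + (j + 1) = N + 2 + j + 1 by ring] at this
      exact_mod_cast this
    refine le_trans ?_ h
    push_cast
    gcongr
  calc ∑ i ∈ Finset.range n, exp (-(cfQ ω (i + 1) : ℝ) * Δ) * (cfQ ω (i + 1) : ℝ) ^ τ
      ≤ ∑ i ∈ Finset.range (N + 2 + n),
          exp (-(cfQ ω (i + 1) : ℝ) * Δ) * (cfQ ω (i + 1) : ℝ) ^ τ :=
        Finset.sum_le_sum_of_subset_of_nonneg
          (Finset.range_subset_range.2 (Nat.le_add_left n _)) fun j _ _ => by positivity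
    _ ≤ ∑ i ∈ Finset.range (N + 2), (τ * exp (-1)) ^ τ * Δ ^ (-τ) +
          ∑ j ∈ Finset.range n, (τ * exp (-1)) ^ τ * Δ ^ (-τ) *
            ((Nat.fib (j + 3) : ℝ) * exp (1 - Nat.fib (j + 3))) ^ τ := by
        rw [Finset.sum_range_add]
        refine add_le_add (Finset.sum_le_sum fun i _ => ?_) (Finset.sum_le_sum fun j _ => ?_)
        · exact exp_neg_mul_rpow_le hτ0 hΔ (Nat.cast_nonneg _)
        · exact exp_neg_mul_rpow_le_of_le hτ0 hΔ
            (by exact_mod_cast Nat.fib_pos.2 (show 0 < j + 3 by omega)) (htail j)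
    _ ≤ _ := by
        rw [Finset.sum_const, Finset.card_range, nsmul_eq_mul, ← Finset.mul_sum, mul_add]
        push_cast
        rw [mul_comm ((N : ℝ) + 2)]
        gcongr
        exact sum_fib_mul_exp_rpow_le hτ n

/-- for a `(C,τ)`-Diophantine irrational `ω ∈ (0,1)` and
`Δ ∈ (0, min(τ⁻¹, τ e⁻¹)]` one has
`𝔅rj₁(Δ) ≤ (C⁻¹ (τe⁻¹)^τ / log φ) Δ^{-τ} (log Δ⁻¹ + log(3τφ) + Γ(τ)/(2(τe⁻¹)^τ))`. -/
theorem brj1_bound_of_diophantine (ω : ℝ) (hirr : Irrational ω) (hω0 : 0 < ω) (hω1 : ω < 1)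
    (C τ : ℝ) (hC : 0 < C) (hτ : 1 ≤ τ) (hdio : IsDiophantine C τ ω)
    (Δ : ℝ) (hΔ0 : 0 < Δ) (hΔ : Δ ≤ min τ⁻¹ (τ * Real.exp (-1))) :
    Brj1 ω Δ ≤ ENNReal.ofReal
      (C⁻¹ * (τ * Real.exp (-1)) ^ τ / Real.log goldenφ * Δ ^ (-τ) *
        (Real.log Δ⁻¹ + Real.log (3 * τ * goldenφ) +
          Real.Gamma τ / (2 * (τ * Real.exp (-1)) ^ τ))) := by
  have hτ0 : 0 < τ := by linarith
  have hQ : 1 ≤ τ / Δ := by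
    rw [one_le_div hΔ0]
    have h1 : Δ ≤ τ * exp (-1) := hΔ.trans (min_le_right _ _)
    exact h1.trans (mul_le_of_le_one_right hτ0.le (exp_le_one_iff.2 (by norm_num)))
  obtain ⟨N, hN, hNlog⟩ := exists_cfQ_crossing hirr hω0 hω1 hQ
  have hlogφ := log_goldenφ_pos
  have hφ0 : 0 < goldenφ := goldenRatio_pos
  set K : ℝ := (τ * exp (-1)) ^ τ with hK
  have hK0 : 0 < K := by positivity
  have hbracket : (N + 2 + 2 / τ) * log goldenφ ≤
      log Δ⁻¹ + log (3 * τ * goldenφ) + Gamma τ / (2 * K) := by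
    have h1 : log (τ / Δ) = log τ + log Δ⁻¹ := by
      rw [div_eq_mul_inv, log_mul hτ0.ne' (inv_ne_zero hΔ0.ne')]
    have h2 : log (3 * τ * goldenφ) = log 3 + log τ + log goldenφ := by
      rw [log_mul (by positivity) hφ0.ne', log_mul (by norm_num) hτ0.ne']
    have h3 : 2 / τ * log goldenφ ≤ Gamma τ / (2 * K) :=
      calc 2 / τ * log goldenφ ≤ 2 / τ * (1 / 2) := by
            gcongr
            exact log_goldenφ_le_half
        _ ≤ Gamma τ / (2 * K) := by
            rw [div_mul_div_comm, div_le_div_iff₀ (by positivity) (by positivity)]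
            linarith [two_mul_rpow_le_mul_Gamma hτ]
    linarith [two_mul_log_goldenφ_le]
  refine ENNReal.tsum_le_of_sum_range_le fun n => ?_
  rw [← ENNReal.ofReal_sum_of_nonneg fun i _ => by positivity]
  refine ENNReal.ofReal_le_ofReal ?_
  calc ∑ i ∈ Finset.range n, exp (-(cfQ ω (i + 1) : ℝ) * Δ) * (cfQ ω (i + 2) : ℝ)
      ≤ ∑ i ∈ Finset.range n, C⁻¹ *
          (exp (-(cfQ ω (i + 1) : ℝ) * Δ) * (cfQ ω (i + 1) : ℝ) ^ τ) := by
        refine Finset.sum_le_sum fun i _ => ?_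
        rw [mul_left_comm]
        gcongr
        exact cfQ_succ_le_of_isDiophantine hirr hω0 hω1 hC hdio (i + 1)
    _ ≤ C⁻¹ * (K * Δ ^ (-τ) * (N + 2 + 2 / τ)) := by
        rw [← Finset.mul_sum]
        gcongr
        exact sum_exp_mul_cfQ_rpow_le hirr hω0 hω1 hτ hΔ0 hN n
    _ = C⁻¹ * K / log goldenφ * Δ ^ (-τ) * ((N + 2 + 2 / τ) * log goldenφ) := by
        field_simp
    _ ≤ _ := by gcongr
end
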